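/- arXiv:2004.09810 — 2 statements merged into one kernel-verified Lean document; each statement's English description precedes it below -/
import Mathlib

section
/- The number of cyclically inequivalent binary de Bruijn sequences of order n is 2^(2^(n-1) - n). -/
namespace Matrix

/-- If `M` is nilpotent over an integral domain, then `1 - M` has determinant one. -/
lemma det_one_sub_of_isNilpotent {n R : Type*} [Fintype n] [DecidableEq n] [CommRing R]
    [IsDomain R] {M : Matrix n n R} (hM : IsNilpotent M) : (1 - M).det = 1 := by
  have h := (isNilpotent_charpoly_sub_pow_of_isNilpotent hM).eq_zero
  have h2 := M.eval_charpoly 1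
  rw [sub_eq_zero.1 h] at h2
  simpa using h2.symm

/-- Moving a vector `d` from one row to another, in both directions, averages out in the
determinant. -/
lemma det_add_det_of_transfer {n R : Type*} [Fintype n] [DecidableEq n] [CommRing R]
    {U A B : Matrix n n R} {i j : n} (hij : i ≠ j) (d : n → R)
    (hA : ∀ k, k ≠ i → k ≠ j → A k = U k) (hB : ∀ k, k ≠ i → k ≠ j → B k = U k)
    (hAi : A i = U i + d) (hAj : A j = U j - d) (hBi : B i = U i - d) (hBj : B j = U j + d) :
    A.det + B.det = 2 * U.det := by
  let f (x y : n → R) : R := (updateRow (updateRow U i x) j y).det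
  have hf (x y : n → R) (X : Matrix n n R) (hX : ∀ k, k ≠ i → k ≠ j → X k = U k) (hi : X i = x)
      (hj : X j = y) : X.det = f x y := by
    refine congrArg det (funext fun k => ?_)
    by_cases hkj : k = j
    · subst hkj
      rw [updateRow_self, hj]
    by_cases hki : k = i
    · subst hki
      rw [updateRow_ne hkj, updateRow_self, hi]
    · rw [updateRow_ne hkj, updateRow_ne hki, hX k hki hkj]
  have hr (x y z : n → R) : f x (y + z) = f x y + f x z := det_updateRow_add _ _ _ _
  have hl (x y z : n → R) : f (x + y) z = f x z + f y z := by
    simp only [f, updateRow_comm _ hij]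
    exact det_updateRow_add _ _ _ _
  have hrn (x y : n → R) : f x (-y) = -f x y := by
    have h0 : f x 0 = 0 := det_eq_zero_of_row_eq_zero j fun k => by simp
    have h := hr x y (-y)
    rw [add_neg_cancel, h0] at h
    linear_combination -h
  have hln (x y : n → R) : f (-x) y = -f x y := by
    have h0 : f 0 y = 0 := det_eq_zero_of_row_eq_zero i fun k => by simp [updateRow_ne hij]
    have h := hl x (-x) y
    rw [add_neg_cancel, h0] at h
    linear_combination -h
  have hdd : f d d = 0 := det_zero_of_row_eq hij (by rw [updateRow_ne hij]; simp)
  rw [hf _ _ A hA hAi hAj, hf _ _ B hB hBi hBj, hf _ _ U (fun _ _ _ => rfl) rfl rfl]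
  simp only [sub_eq_add_neg, hl, hr, hln, hrn, hdd]
  ring

/-- The determinant of `1 - P + J / N`, for the permutation matrix `P` of a cyclic shift on `N`
points and the all-ones matrix `J`, is `N`. -/
lemma det_one_sub_shift_add_const {K : Type*} [Field K] [CharZero K] (m : ℕ) :
    (of fun i j : Fin (m + 1) => (if i = j then 1 else 0) - (if i + 1 = j then 1 else 0)
      + (1 : K) / (m + 1)).det = m + 1 := by
  let V : Matrix (Fin (m + 1)) (Fin (m + 1)) K := of fun i j =>
    (if i = j then 1 else 0) - (if i.val + 1 = j.val then 1 else 0)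
  let w : Fin (m + 1) → K := fun i => (m + 1 - i.val) / (m + 1)
  let A : Matrix (Fin (m + 1)) (Fin 2) K := of fun i => ![1, w i]
  let B : Matrix (Fin 2) (Fin (m + 1)) K := of ![fun j => if j = 0 then -1 else 0, fun _ => 1]
  have hV : V.det = 1 := by
    rw [det_of_isUpperTriangular]
    · simp [V]
    · intro i j hij
      have h1 : i ≠ j := ne_of_gt hij
      have h2 : ¬ i.val + 1 = j.val := by
        have : j.val < i.val := hij
        omega
      simp [V, h1, h2]
  have hAB (i j) : (1 + A * B : Matrix _ _ K) i j = (if i = j then 1 else 0) - (if j = 0 then 1 else 0) + w i := by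
    simp only [add_apply, mul_apply, Fin.sum_univ_two, one_apply, A, B, of_apply]
    simp
    split_ifs <;> ring
  have hfac : (of fun i j : Fin (m + 1) => (if i = j then 1 else 0) -
      (if i + 1 = j then 1 else 0) + (1 : K) / (m + 1)) = V * (1 + A * B) := by
    ext i j
    rw [mul_apply]
    simp only [hAB, V, of_apply, sub_mul, Finset.sum_sub_distrib, ite_mul, one_mul, zero_mul,
      Finset.sum_ite_eq, Finset.mem_univ, if_true]
    induction i using Fin.lastCases with
    | last =>
      have : ∀ x : Fin (m + 1), ¬ m + 1 = x.val := fun x => by have := x.isLt; omega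
      simp only [Fin.val_last, this, Fin.last_add_one, w]
      simp [eq_comm (a := (0 : Fin (m + 1)))]
    | cast i =>
      have : ∀ x : Fin (m + 1), i.castSucc.val + 1 = x.val ↔ i.succ = x := fun x => by
        rw [Fin.ext_iff]; simp
      simp only [this, Finset.sum_ite_eq, Finset.mem_univ, if_true, Fin.coeSucc_eq_succ, w]
      simp only [Fin.val_castSucc, Fin.val_succ]
      push_cast
      field_simp
      ring
  rw [hfac, det_mul, hV, one_mul, det_one_add_mul_comm, det_fin_two]
  have hBA (a b) : (1 + B * A : Matrix _ _ K) a b =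
      (if a = b then 1 else 0) + ∑ l, B a l * A l b := by
    rw [add_apply, mul_apply, one_apply]
  simp only [hBA]
  simp [A, B, w]

end Matrix


lemma exists_zmod_equiv_of_isCycleOn {α : Type*} [Fintype α] {σ : Equiv.Perm α}
    (hσ : σ.IsCycleOn Set.univ) {N : ℕ} [NeZero N] (hN : Fintype.card α = N) :
    ∃ e : ZMod N ≃ α, ∀ i, e (i + 1) = σ (e i) := by
  classical
  have : Nonempty α := Fintype.card_pos_iff.1 (hN ▸ Nat.pos_of_neZero N)
  let a : α := Classical.arbitrary α
  have h : σ.IsCycleOn (Finset.univ : Finset α) := by simpa using hσ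
  have hc : (Finset.univ : Finset α).card = N := by simpa using hN
  have hmod {m n : ℕ} : (σ ^ m) a = (σ ^ n) a ↔ m ≡ n [MOD N] := by
    rw [h.pow_apply_eq_pow_apply (Finset.mem_univ a), hc]
  have hinj : Function.Injective fun i : ZMod N => (σ ^ i.val) a := by
    intro i j hij
    have := (ZMod.natCast_eq_natCast_iff _ _ _).2 (hmod.1 hij)
    simpa using this
  refine ⟨Equiv.ofBijective _ ((Fintype.bijective_iff_injective_and_card _).2
    ⟨hinj, by simp [ZMod.card, hN]⟩), fun i => ?_⟩
  change (σ ^ (i + 1).val) a = σ ((σ ^ i.val) a)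
  rw [← Equiv.Perm.mul_apply, ← pow_succ', hmod, ← ZMod.natCast_eq_natCast_iff]
  simp

/-- The determinant of `1 - P + J / N`, for a permutation matrix `P` and the all-ones matrix `J`,
detects whether the permutation is a single cycle on all `N` points. -/
lemma Matrix.det_one_sub_perm_add_const {α K : Type*} [Fintype α] [DecidableEq α]
    [Nonempty α] [Field K] [CharZero K] (σ : Equiv.Perm α) [Decidable (σ.IsCycleOn Set.univ)] :
    (Matrix.of fun x y : α => (if x = y then 1 else 0) - (if σ x = y then 1 else 0)
      + (1 : K) / Fintype.card α).det =
      if σ.IsCycleOn Set.univ then (Fintype.card α : K) else 0 := by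
  split_ifs with h
  · obtain ⟨m, hm⟩ := Nat.exists_eq_succ_of_ne_zero (Fintype.card_ne_zero (α := α))
    obtain ⟨e, he⟩ := exists_zmod_equiv_of_isCycleOn h hm
    let e' : Fin (m + 1) ≃ α := e
    have he' (i : Fin (m + 1)) : σ (e' i) = e' (i + 1) := (he i).symm
    rw [← Matrix.det_submatrix_equiv_self e', hm]
    have := Matrix.det_one_sub_shift_add_const (K := K) m
    simpa [Matrix.submatrix, he'] using this
  · by_contra hdet
    apply h
    refine ⟨σ.bijective.bijOn_univ, fun x _ y _ => ?_⟩
    classical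
    by_contra hxy
    let f : α → K := fun z => if σ.SameCycle x z then 1 else 0
    let c : K := (∑ z, f z) / Fintype.card α
    have hf (z) : f (σ z) = f z := by simp [f]
    apply hdet
    rw [← Matrix.exists_mulVec_eq_zero_iff]
    refine ⟨fun z => f z - c, fun h0 => ?_, ?_⟩
    · have h1 := congrFun h0 x
      have h2 := congrFun h0 y
      simp only [Pi.zero_apply, sub_eq_zero] at h1 h2
      rw [← h2] at h1
      simp [f, hxy, Equiv.Perm.SameCycle.refl] at h1
    · ext z
      simp only [Matrix.mulVec, dotProduct, Matrix.of_apply, add_mul, sub_mul, ite_mul, one_mul,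
        zero_mul, Finset.sum_add_distrib, Finset.sum_sub_distrib, Finset.sum_ite_eq,
        Finset.mem_univ, if_true, hf, ← Finset.mul_sum, Pi.zero_apply]
      simp only [Finset.sum_const, Finset.card_univ, nsmul_eq_mul, c]
      field_simp
      ring

namespace DeBruijn

/-- The nonsingular feedback shift register on binary `(k + 1)`-tuples with feedback function
`x ↦ x 0 + g (x 1, …, x k)`. -/
def feedbackShift {k : ℕ} (g : (Fin k → ZMod 2) → ZMod 2) : Equiv.Perm (Fin (k + 1) → ZMod 2) where
  toFun x := Fin.snoc (Fin.tail x) (x 0 + g (Fin.tail x))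
  invFun y := Fin.cons (y (Fin.last k) - g (Fin.init y)) (Fin.init y)
  left_inv x := by simp
  right_inv y := by simp

lemma feedbackShift_apply {k : ℕ} (g : (Fin k → ZMod 2) → ZMod 2) (x : Fin (k + 1) → ZMod 2) :
    feedbackShift g x = Fin.snoc (Fin.tail x) (x 0 + g (Fin.tail x)) := rfl

/-- The sign `±1` attached to a bit. -/
def sign (a : ZMod 2) : ℚ := if a = 0 then 1 else -1

/-- Perturb each row `x` of `U` by `± d (tail x)`, with opposite signs in the two rows that share a
tail. Summed over all choices of signs, the determinants average to that of `U`. -/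
lemma sum_det_add_sign_mul {k : ℕ}
    (U : Matrix (Fin (k + 1) → ZMod 2) (Fin (k + 1) → ZMod 2) ℚ)
    (d : (Fin k → ZMod 2) → (Fin (k + 1) → ZMod 2) → ℚ) :
    ∑ g : (Fin k → ZMod 2) → ZMod 2,
      (Matrix.of fun x y => U x y + sign (x 0 + g (Fin.tail x)) * d (Fin.tail x) y).det =
      2 ^ 2 ^ k * U.det := by
  classical
  let D (S : Finset (Fin k → ZMod 2)) (g : (Fin k → ZMod 2) → ZMod 2) :
      Matrix (Fin (k + 1) → ZMod 2) (Fin (k + 1) → ZMod 2) ℚ := Matrix.of fun x y =>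
    U x y + if Fin.tail x ∈ S then 0 else sign (x 0 + g (Fin.tail x)) * d (Fin.tail x) y
  have hstep (S) (a) (ha : a ∉ S) : ∑ g, (D S g).det = ∑ g, (D (insert a S) g).det := by
    have hflip : ∑ g, (D S g).det = ∑ g, (D S (g + Pi.single a 1)).det :=
      (Equiv.sum_comp (Equiv.addRight (Pi.single a 1)) fun g => (D S g).det).symm
    have hpair (g) : (D S g).det + (D S (g + Pi.single a 1)).det = 2 * (D (insert a S) g).det := by
      have hrow (x) (hx : x ≠ Fin.cons (α := fun _ => ZMod 2) (g a) a)
          (hx' : x ≠ Fin.cons (α := fun _ => ZMod 2) (g a + 1) a) :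
          Fin.tail x ≠ a := by
        rintro rfl
        have h0 : x 0 ≠ g (Fin.tail x) := fun h => hx (by rw [← h, Fin.cons_self_tail])
        have h1 : x 0 ≠ g (Fin.tail x) + 1 := fun h => hx' (by rw [← h, Fin.cons_self_tail])
        revert h0 h1
        generalize x 0 = b
        generalize g (Fin.tail x) = c
        revert b c
        decide
      have hb (b : ZMod 2) : b + b = 0 := by revert b; decide
      have hb1 (b : ZMod 2) : b + 1 + b = 1 := by revert b; decide
      have hs0 : sign 0 = 1 := by simp [sign]
      have hs1 : sign 1 = -1 := by simp [sign]
      refine Matrix.det_add_det_of_transfer (i := Fin.cons (g a) a) (j := Fin.cons (g a + 1) a)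
        (fun h => ?_) (d a) (fun x hx hx' => ?_) (fun x hx hx' => ?_) ?_ ?_ ?_ ?_
      · have := congrFun h 0
        simp at this
      · have := hrow x hx hx'
        ext y
        simp [D, this]
      · have := hrow x hx hx'
        ext y
        simp [D, this]
      all_goals
        ext y
        simp [D, ha, hb, hb1, hs0, hs1, ← add_assoc, sub_eq_add_neg]
    have : 2 * ∑ g, (D S g).det = 2 * ∑ g, (D (insert a S) g).det := by
      rw [two_mul]
      nth_rw 2 [hflip]
      rw [← Finset.sum_add_distrib, Finset.mul_sum]
      exact Finset.sum_congr rfl fun g _ => hpair g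
    linarith
  have hall (S) : ∑ g, (D ∅ g).det = ∑ g, (D S g).det := by
    induction S using Finset.induction_on with
    | empty => rfl
    | insert a S ha ih => rw [ih, hstep S a ha]
  have h0 := hall Finset.univ
  simp only [D, Finset.notMem_empty, Finset.mem_univ, if_true, if_false, add_zero,
    Finset.sum_const, nsmul_eq_mul] at h0
  rw [h0]
  simp [ZMod.card]
  rfl

/-- The centred transition matrix of the simple random walk on the de Bruijn graph. -/
def walk (k : ℕ) : Matrix (Fin (k + 1) → ZMod 2) (Fin (k + 1) → ZMod 2) ℚ :=
  Matrix.of fun x y => (if Fin.tail x = Fin.init y then 1 / 2 else 0) - 1 / 2 ^ (k + 1)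

lemma walk_mulVec {k : ℕ} (f : (Fin (k + 1) → ZMod 2) → ℚ) (x : Fin (k + 1) → ZMod 2) :
    (walk k).mulVec f x = (∑ c : ZMod 2, f (Fin.snoc (Fin.tail x) c)) / 2
      - (∑ y, f y) / 2 ^ (k + 1) := by
  simp only [Matrix.mulVec, dotProduct, walk, Matrix.of_apply, sub_mul, Finset.sum_sub_distrib,
    ← Finset.mul_sum]
  congr 1
  · rw [← (Fin.snocEquiv fun _ => ZMod 2).sum_comp, Fintype.sum_prod_type]
    have hsnoc (p : ZMod 2 × (Fin k → ZMod 2)) :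
        Fin.snocEquiv (fun _ => ZMod 2) p = Fin.snoc (α := fun _ => ZMod 2) p.2 p.1 := rfl
    simp only [hsnoc, Fin.init_snoc, ite_mul, zero_mul, Finset.sum_ite_eq,
      Finset.mem_univ, if_true, Finset.sum_div]
    exact Finset.sum_congr rfl fun c _ => by ring
  · ring

lemma isNilpotent_walk (k : ℕ) : IsNilpotent (walk k) := by
  have key (f : (Fin (k + 1) → ZMod 2) → ℚ) (j : ℕ) (x x' : Fin (k + 1) → ZMod 2)
      (h : ∀ i : Fin (k + 1), j ≤ i.val → x i = x' i) :
      (walk k ^ j).mulVec f x = (walk k ^ j).mulVec f x' := by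
    induction j generalizing x x' with
    | zero => rw [funext fun i => h i (Nat.zero_le _)]
    | succ j ih =>
      rw [pow_succ', ← Matrix.mulVec_mulVec, walk_mulVec, walk_mulVec]
      congr 2
      refine Finset.sum_congr rfl fun c _ => ih _ _ fun i hi => ?_
      induction i using Fin.lastCases with
      | last => simp
      | cast i =>
        simp only [Fin.snoc_castSucc, Fin.tail]
        exact h _ (by simpa using hi)
  refine ⟨k + 1 + 1, ?_⟩
  ext x y
  have hconst : (walk k ^ (k + 1)).mulVec (Pi.single y 1) =
      fun _ => (walk k ^ (k + 1)).mulVec (Pi.single y 1) 0 :=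
    funext fun z => key _ _ _ _ fun i hi => absurd i.isLt (by omega)
  have h : (walk k ^ (k + 1 + 1)).mulVec (Pi.single y 1) x = 0 := by
    rw [pow_succ', ← Matrix.mulVec_mulVec, hconst, walk_mulVec]
    simp [ZMod.card]
  simpa using h

lemma feedbackShift_matrix_eq {k : ℕ} (g : (Fin k → ZMod 2) → ZMod 2)
    (x y : Fin (k + 1) → ZMod 2) :
    (if x = y then 1 else 0) - (if feedbackShift g x = y then 1 else 0)
      + (1 : ℚ) / Fintype.card (Fin (k + 1) → ZMod 2) =
    (1 - walk k) x y + sign (x 0 + g (Fin.tail x)) *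
      (if Fin.tail x = Fin.init y then - sign (y (Fin.last k)) / 2 else 0) := by
  have h : feedbackShift g x = y ↔
      Fin.tail x = Fin.init y ∧ x 0 + g (Fin.tail x) = y (Fin.last k) := by
    rw [feedbackShift_apply]
    nth_rw 1 [← Fin.snoc_init_self y]
    exact Fin.snoc_inj
  have hs (a b : ZMod 2) : (if a = b then 1 else 0) = 1 / 2 + sign a * (sign b / 2) := by
    have ha : a = 0 ∨ a = 1 := by revert a; decide
    have hb : b = 0 ∨ b = 1 := by revert b; decide
    rcases ha with rfl | rfl <;> rcases hb with rfl | rfl <;> norm_num [sign]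
  have hs' := hs (x 0 + g (Fin.tail x)) (y (Fin.last k))
  simp only [h, walk, Matrix.sub_apply, Matrix.one_apply, Matrix.of_apply]
  by_cases hxy : Fin.tail x = Fin.init y
  · simp only [hxy, true_and, if_true] at hs' ⊢
    rw [hs']
    simp [ZMod.card]
    ring
  · simp [hxy, ZMod.card]

open Classical in
/-- The number of feedback functions whose shift register is a single cycle. -/
lemma card_isCycleOn_feedbackShift (k : ℕ) :
    Nat.card {g : (Fin k → ZMod 2) → ZMod 2 // (feedbackShift g).IsCycleOn Set.univ} =
      2 ^ (2 ^ k - (k + 1)) := by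
  have h := sum_det_add_sign_mul (1 - walk k) fun v y =>
    if v = Fin.init y then - sign (y (Fin.last k)) / 2 else 0
  simp only [← feedbackShift_matrix_eq] at h
  rw [Matrix.det_one_sub_of_isNilpotent (isNilpotent_walk k), mul_one] at h
  simp only [Matrix.det_one_sub_perm_add_const] at h
  rw [← Finset.sum_filter, Finset.sum_const, nsmul_eq_mul] at h
  rw [Nat.card_eq_fintype_card, Fintype.card_subtype]
  have h2 : (Finset.univ.filter fun g : (Fin k → ZMod 2) → ZMod 2 =>
      (feedbackShift g).IsCycleOn Set.univ).card * 2 ^ (k + 1) = 2 ^ 2 ^ k := by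
    have : (Fintype.card (Fin (k + 1) → ZMod 2)) = 2 ^ (k + 1) := by simp [ZMod.card]
    rw [this] at h
    exact_mod_cast h
  have hk : k + 1 ≤ 2 ^ k := Nat.lt_two_pow_self
  refine Nat.eq_of_mul_eq_mul_right (pow_pos two_pos (k + 1)) ?_
  rw [h2, ← pow_add, Nat.sub_add_cancel hk]

/-- The window of length `m` of a cyclic sequence that starts at position `i`. -/
def window {N : ℕ} (m : ℕ) (s : ZMod N → ZMod 2) (i : ZMod N) : Fin m → ZMod 2 :=
  fun j => s (i + (j.val : ZMod N))

section Window

variable {N k : ℕ} {s : ZMod N → ZMod 2}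

lemma tail_window (i : ZMod N) :
    Fin.tail (window (k + 1) s i) = Fin.init (window (k + 1) s (i + 1)) := by
  ext j
  simp [Fin.tail, Fin.init, window, add_comm, add_left_comm]

lemma window_zero (i : ZMod N) : window (k + 1) s i 0 = s i := by
  simp [window]

/-- A sequence with distinct windows follows a unique feedback function. -/
lemma existsUnique_feedback (hs : Function.Bijective (window (k + 1) s)) :
    ∃! g, ∀ i, window (k + 1) s (i + 1) = feedbackShift g (window (k + 1) s i) := by
  have hsucc (i) (g : (Fin k → ZMod 2) → ZMod 2) :
      window (k + 1) s (i + 1) = feedbackShift g (window (k + 1) s i) ↔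
      window (k + 1) s (i + 1) (Fin.last k) =
        window (k + 1) s i 0 + g (Fin.tail (window (k + 1) s i)) := by
    rw [feedbackShift_apply, tail_window]
    nth_rw 1 [← Fin.snoc_init_self (window (k + 1) s (i + 1))]
    rw [Fin.snoc_inj]
    simp
  choose p hp using fun v : Fin k → ZMod 2 => hs.2 (Fin.cons 0 v)
  refine ⟨fun v => window (k + 1) s (p v + 1) (Fin.last k), fun i => ?_, fun g hg => ?_⟩
  · rw [hsucc]
    set v := Fin.tail (window (k + 1) s i) with hv
    have hinit : Fin.init (window (k + 1) s (i + 1)) = Fin.init (window (k + 1) s (p v + 1)) := by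
      rw [← tail_window, ← tail_window, hp]
      simp [v]
    have hiff : window (k + 1) s i 0 = 0 ↔ window (k + 1) s (i + 1) (Fin.last k) =
        window (k + 1) s (p v + 1) (Fin.last k) := by
      constructor
      · intro h0
        have : i = p v := hs.1 (by
          rw [hp, ← Fin.cons_self_tail (window (k + 1) s i), h0])
        rw [← this]
      · intro hlast
        have : i + 1 = p v + 1 := hs.1 (by
          rw [← Fin.snoc_init_self (window (k + 1) s (i + 1)), hinit, hlast, Fin.snoc_init_self])
        rw [add_right_cancel this, hp, Fin.cons_zero]
    have hbit (a b c : ZMod 2) (h : a = 0 ↔ b = c) : b = a + c := by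
      revert a b c; decide
    exact hbit _ _ _ hiff
  · ext v
    have := (hsucc _ _).1 (hg (p v))
    rw [hp] at this
    simpa using this.symm

/-- If a feedback function generates a sequence with all windows, its register is one cycle. -/
lemma isCycleOn_of_feedback [NeZero N] (hs : Function.Bijective (window (k + 1) s))
    {g : (Fin k → ZMod 2) → ZMod 2}
    (hg : ∀ i, window (k + 1) s (i + 1) = feedbackShift g (window (k + 1) s i)) :
    (feedbackShift g).IsCycleOn Set.univ := by
  refine ⟨(feedbackShift g).bijective.bijOn_univ, fun x _ y _ => ?_⟩
  obtain ⟨i, rfl⟩ := hs.2 x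
  obtain ⟨j, rfl⟩ := hs.2 y
  have h (m : ℕ) : (feedbackShift g ^ m) (window (k + 1) s i) = window (k + 1) s (i + m) := by
    induction m with
    | zero => simp
    | succ m ih => rw [pow_succ', Equiv.Perm.mul_apply, ih, ← hg]; push_cast; rw [add_assoc]
  refine ⟨((j - i).val : ℕ), ?_⟩
  rw [zpow_natCast, h]
  simp

lemma exists_shift_of_feedback [NeZero N] {t : ZMod N → ZMod 2}
    (hs : Function.Bijective (window (k + 1) s)) {g : (Fin k → ZMod 2) → ZMod 2}
    (hg : ∀ i, window (k + 1) s (i + 1) = feedbackShift g (window (k + 1) s i))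
    (hg' : ∀ i, window (k + 1) t (i + 1) = feedbackShift g (window (k + 1) t i)) :
    ∃ c, ∀ i, s (i + c) = t i := by
  obtain ⟨c, hc⟩ := hs.2 (window (k + 1) t 0)
  have h (m : ℕ) : window (k + 1) s (m + c) = window (k + 1) t m := by
    induction m with
    | zero => simpa using hc
    | succ m ih =>
      push_cast
      rw [add_right_comm, hg, hg', ih]
  refine ⟨c, fun i => ?_⟩
  have := congrFun (h i.val) 0
  simpa [window_zero] using this

end Window

lemma exists_sequence_of_isCycleOn {k : ℕ} {g : (Fin k → ZMod 2) → ZMod 2}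
    (hg : (feedbackShift g).IsCycleOn Set.univ) :
    ∃ s : ZMod (2 ^ (k + 1)) → ZMod 2, Function.Bijective (window (k + 1) s) ∧
      ∀ i, window (k + 1) s (i + 1) = feedbackShift g (window (k + 1) s i) := by
  obtain ⟨e, he⟩ := exists_zmod_equiv_of_isCycleOn hg (N := 2 ^ (k + 1)) (by simp [ZMod.card])
  have key (m : ℕ) (hm : m < k + 1) (i) : e (i + m) 0 = e i ⟨m, hm⟩ := by
    induction m generalizing i with
    | zero => simp
    | succ m ih =>
      have h1 : i + ((m + 1 : ℕ) : ZMod (2 ^ (k + 1))) = i + 1 + m := by push_cast; ring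
      rw [h1, ih (by omega), he, feedbackShift_apply]
      have h2 : (⟨m, by omega⟩ : Fin (k + 1)) = Fin.castSucc ⟨m, by omega⟩ := rfl
      rw [h2, Fin.snoc_castSucc]
      rfl
  refine ⟨fun i => e i 0, ?_⟩
  have hw : window (k + 1) (fun i => e i 0) = e :=
    funext fun i => funext fun j => key j.val j.isLt i
  rw [hw]
  exact ⟨e.bijective, he⟩

end DeBruijn

/-- The number of cyclically inequivalent binary de Bruijn sequences of
order `n` is `2^(2^(n-1) - n)`.  A de Bruijn sequence of order `n` is modeled as a
function `s : ZMod (2^n) → ZMod 2` (a cyclic sequence of length `2^n`) such that every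
binary `n`-tuple occurs exactly once as a window of `n` consecutive entries.  Two such
sequences are identified when one is a cyclic shift of the other. -/
theorem deBruijn_count (n : ℕ) (hn : 1 ≤ n) :
    Nat.card (Quot (fun s t : {s : ZMod (2 ^ n) → ZMod 2 //
        ∀ w : Fin n → ZMod 2, ∃! i : ZMod (2 ^ n),
          ∀ j : Fin n, s (i + (j.val : ZMod (2 ^ n))) = w j} =>
      ∃ c : ZMod (2 ^ n), ∀ i : ZMod (2 ^ n), s.val (i + c) = t.val i)) =
    2 ^ (2 ^ (n - 1) - n) := by
  obtain ⟨k, rfl⟩ : ∃ k, n = k + 1 := ⟨n - 1, by omega⟩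
  have hbij (s : {s : ZMod (2 ^ (k + 1)) → ZMod 2 //
        ∀ w : Fin (k + 1) → ZMod 2, ∃! i : ZMod (2 ^ (k + 1)),
          ∀ j : Fin (k + 1), s (i + (j.val : ZMod (2 ^ (k + 1)))) = w j}) :
      Function.Bijective (DeBruijn.window (k + 1) s.val) := by
    rw [Function.bijective_iff_existsUnique]
    intro w
    simpa [funext_iff, DeBruijn.window] using s.2 w
  choose G hG hGuniq using fun s => DeBruijn.existsUnique_feedback (hbij s)
  rw [Nat.add_sub_cancel, ← DeBruijn.card_isCycleOn_feedbackShift]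
  refine Nat.card_congr (Equiv.ofBijective (Quot.lift (fun s =>
    ⟨G s, DeBruijn.isCycleOn_of_feedback (hbij s) (hG s)⟩) ?_) ⟨?_, ?_⟩)
  · rintro s t ⟨c, hc⟩
    refine Subtype.ext (hGuniq t _ fun i => ?_)
    have hw (i) : DeBruijn.window (k + 1) t.val i = DeBruijn.window (k + 1) s.val (i + c) := by
      ext j
      simp only [DeBruijn.window, ← hc]
      rw [add_right_comm]
    rw [hw, hw, add_right_comm, hG]
  · rintro ⟨s⟩ ⟨t⟩ hst
    have hst' : G s = G t := congrArg Subtype.val hst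
    exact Quot.sound (DeBruijn.exists_shift_of_feedback (hbij s) (hG s) (hst' ▸ hG t))
  · rintro ⟨g, hg⟩
    obtain ⟨s, hs, hsg⟩ := DeBruijn.exists_sequence_of_isCycleOn hg
    refine ⟨Quot.mk _ ⟨s, fun w => ?_⟩, Subtype.ext ?_⟩
    · simpa [funext_iff, DeBruijn.window] using (Function.bijective_iff_existsUnique _).1 hs w
    · exact (hGuniq _ g hsg).symm
end

section
/- If a binary periodic sequence s is generated by a k-stage feedback shift register where k equals the nonlinear complexity of s, then each k-stage state (window of k consecutive bits) appears at most once in each period of s. -/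
/-- `s` satisfies a feedback (nonlinear) recurrence of order `k`. -/
def GenBy (s : ℕ → ZMod 2) (k : ℕ) : Prop :=
  ∃ h : (Fin k → ZMod 2) → ZMod 2, ∀ i : ℕ, s (i + k) = h (fun j => s (i + j.val))

/-- Two equal windows of length `k` in a sequence with a recurrence of order `k` have equal
continuations. -/
theorem GenBy.eq_of_window_eq {s : ℕ → ZMod 2} {k : ℕ} (hs : GenBy s k) {i j : ℕ}
    (hw : ∀ t : Fin k, s (i + t.val) = s (j + t.val)) (m : ℕ) : s (i + m) = s (j + m) := by
  obtain ⟨h, hh⟩ := hs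
  induction m using Nat.strong_induction_on with
  | _ m ih =>
    rcases lt_or_ge m k with hm | hm
    · exact hw ⟨m, hm⟩
    · obtain ⟨n, rfl⟩ := Nat.exists_eq_add_of_le' hm
      rw [← Nat.add_assoc, ← Nat.add_assoc, hh, hh]
      congr 1
      funext t
      rw [Nat.add_assoc, Nat.add_assoc]
      exact ih _ (Nat.add_lt_add_left t.isLt n)

/-- If a binary periodic sequence `s` (with least period `N`) is generated
by a `k`-stage FSR where `k` is the nonlinear complexity of `s`, then each `k`-stage
state (window of `k` consecutive bits) appears at most once in each period of `s`. -/
theorem window_injective_of_nlc (s : ℕ → ZMod 2) (N k : ℕ)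
    (hN : 0 < N) (hper : ∀ i, s (i + N) = s i)
    (hleast : ∀ M, 0 < M → (∀ i, s (i + M) = s i) → N ≤ M)
    (hnlc : IsLeast {k | GenBy s k} k) :
    ∀ i j, i < N → j < N → (∀ t : Fin k, s (i + t.val) = s (j + t.val)) → i = j := by
  have hlt : ∀ i j, i < j → j < N → ¬ ∀ t : Fin k, s (i + t.val) = s (j + t.val) := by
    intro i j hij hj hw
    have hshift : ∀ n, s (n + (j - i)) = s n := by
      intro n
      have h := GenBy.eq_of_window_eq hnlc.1 hw (n + (N - i))
      rw [show i + (n + (N - i)) = n + N by omega,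
        show j + (n + (N - i)) = n + (j - i) + N by omega, hper, hper] at h
      exact h.symm
    have := hleast (j - i) (by omega) hshift
    omega
  intro i j hi hj hw
  rcases lt_trichotomy i j with h | h | h
  · exact (hlt i j h hj hw).elim
  · exact h
  · exact (hlt j i h hi fun t => (hw t).symm).elim
end
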